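/- (Lemma A.1: weighted interior regularity with zero boundary data) Let d ≥ 1, R > 0, k ≥ 1, and let φ : ℝ^d → ℝ be C^∞, nonnegative, with compact support contained in U(R). There exist ε₀ > 0 and a constant C depending only on R, φ, k and d (not on ε or a) such that for all ε ∈ (0, ε₀] and all a ≥ 0 the following holds: if h : (εℤ)^d → ℝ vanishes at every point of (εℤ)^d \ U_ε(R) and g : (εℤ)^d → ℝ satisfies a·h(x) − (Δ_ε h)(x) = g(x) for all x ∈ U_ε(R), then ‖h‖_{φ,k} ≤ C ‖g‖_{H_{k−1}(U_ε(R))}. -/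

import Mathlib

open scoped ENNReal BigOperators

namespace FRD

abbrev Pt (d : ℕ) := Fin d → ℝ
abbrev Idx (d : ℕ) := Fin d → ℤ

variable {d : ℕ}

/-- The lattice point of `(εℤ)^d` with integer coordinates `k`. -/
noncomputable def toPt (ε : ℝ) (k : Idx d) : Pt d := fun i => ε * (k i : ℝ)

/-- The lattice `(εℤ)^d` as a subset of `ℝ^d`. -/
def latt (d : ℕ) (ε : ℝ) : Set (Pt d) := Set.range (toPt (d := d) ε)

/-- Signed unit direction: `e.1` is the coordinate, `e.2` the sign. -/
noncomputable def sdir (d : ℕ) (e : Fin d × Bool) : Pt d :=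
  Pi.single e.1 (if e.2 then (1 : ℝ) else -1)

/-- Forward/backward lattice derivative in the signed direction `e`. -/
noncomputable def nabla (ε : ℝ) (e : Fin d × Bool) (f : Pt d → ℝ) (x : Pt d) : ℝ :=
  ε⁻¹ * (f (x + ε • sdir d e) - f x)

/-- Iterated lattice derivative. -/
noncomputable def nablaList (ε : ℝ) : List (Fin d × Bool) → (Pt d → ℝ) → Pt d → ℝ
  | [], f => f
  | e :: es, f => nabla ε e (nablaList ε es f)

/-- Lattice Laplacian `Δ_ε`. -/
noncomputable def latLap (ε : ℝ) (f : Pt d → ℝ) (x : Pt d) : ℝ :=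
  ε⁻¹ ^ 2 * ∑ μ : Fin d,
    (f (x + ε • (Pi.single μ 1 : Pt d)) + f (x - ε • (Pi.single μ 1 : Pt d)) - 2 * f x)

/-- Open cube of edge length `R` centered at `z` (sup-metric). -/
def cubeC (z : Pt d) (R : ℝ) : Set (Pt d) := {x | ∀ i, |x i - z i| < R / 2}

/-- `U_ε(R)` (centered at `z`). -/
def UC (ε : ℝ) (z : Pt d) (R : ℝ) : Set (Pt d) := cubeC z R ∩ latt d ε

/-- Lattice boundary `∂U_ε(R)` (centered at `z`). -/
def bdryC (ε : ℝ) (z : Pt d) (R : ℝ) : Set (Pt d) :=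
  {y | y ∈ latt d ε ∧ y ∉ UC ε z R ∧ ∃ x ∈ UC ε z R, ‖x - y‖ = ε}

/-- `Ū_ε(R) = U_ε(R) ∪ ∂U_ε(R)`. -/
def clC (ε : ℝ) (z : Pt d) (R : ℝ) : Set (Pt d) := UC ε z R ∪ bdryC ε z R

/-- `h` solves the lattice Dirichlet problem on the cube of edge `R` centered at `z`,
with mass `a` and boundary data `f`. -/
def IsDirSol (ε : ℝ) (z : Pt d) (R a : ℝ) (f h : Pt d → ℝ) : Prop :=
  (∀ x ∈ UC ε z R, a * h x - latLap ε h x = 0) ∧ ∀ x ∈ bdryC ε z R, h x = f x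

/-- Lattice integral of `F` over the lattice points lying in `X` (`ℝ≥0∞`-valued). -/
noncomputable def eint (ε : ℝ) (X : Set (Pt d)) (F : Pt d → ℝ) : ℝ≥0∞ :=
  ∑' k : Idx d, Set.indicator X (fun x => ENNReal.ofReal (ε ^ d * F x)) (toPt ε k)

/-- Squared lattice Sobolev norm `‖f‖²_{H_K(X_ε)}`. -/
noncomputable def sobSq (ε : ℝ) (K : ℕ) (X : Set (Pt d)) (f : Pt d → ℝ) : ℝ≥0∞ :=
  ∑ j ∈ Finset.range (K + 1), (2 : ℝ≥0∞)⁻¹ ^ j *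
    ∑ es : Fin j → Fin d × Bool,
      eint ε X fun x => (nablaList ε (List.ofFn es) f x) ^ 2

/-- Lattice Sobolev norm `‖f‖_{H_K(X_ε)}`. -/
noncomputable def sobNorm (ε : ℝ) (K : ℕ) (X : Set (Pt d)) (f : Pt d → ℝ) : ℝ≥0∞ :=
  sobSq ε K X f ^ (1/2 : ℝ)

/-- Real-valued lattice integral over the whole lattice. -/
noncomputable def lint (ε : ℝ) (F : Pt d → ℝ) : ℝ := ε ^ d * ∑' k : Idx d, F (toPt ε k)

/-- Squared weighted lattice Sobolev norm `‖f‖²_{φ,K}`. -/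
noncomputable def wSobSq (ε : ℝ) (K : ℕ) (φ : Pt d → ℝ) (f : Pt d → ℝ) : ℝ≥0∞ :=
  ∑ j ∈ Finset.range (K + 1), (2 : ℝ≥0∞)⁻¹ ^ j *
    ∑ es : Fin j → Fin d × Bool,
      ∑' k : Idx d, ENNReal.ofReal
        (ε ^ d * φ (toPt ε k) * (nablaList ε (List.ofFn es) f (toPt ε k)) ^ 2)

/-- Weighted lattice Sobolev norm `‖f‖_{φ,K}`. -/
noncomputable def wSobNorm (ε : ℝ) (K : ℕ) (φ : Pt d → ℝ) (f : Pt d → ℝ) : ℝ≥0∞ :=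
  wSobSq ε K φ f ^ (1/2 : ℝ)


/-! ### Integer-indexed reformulation -/

/-- Signed unit direction in index space. -/
def zdir (e : Fin d × Bool) : Idx d := Pi.single e.1 (if e.2 then 1 else -1)

/-- Lattice derivative in index space. -/
noncomputable def zn (ε : ℝ) (e : Fin d × Bool) (u : Idx d → ℝ) (k : Idx d) : ℝ :=
  ε⁻¹ * (u (k + zdir e) - u k)

/-- Iterated lattice derivative in index space. -/
noncomputable def znL (ε : ℝ) : List (Fin d × Bool) → (Idx d → ℝ) → Idx d → ℝ
  | [], f => f
  | e :: es, f => zn ε e (znL ε es f)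

/-- Laplacian in index space. -/
noncomputable def zlap (ε : ℝ) (u : Idx d → ℝ) (k : Idx d) : ℝ :=
  ε⁻¹ * ∑ e : Fin d × Bool, zn ε e u k

/-- Finite support. -/
def FS (u : Idx d → ℝ) : Prop := (Function.support u).Finite

theorem toPt_add (ε : ℝ) (k l : Idx d) : toPt ε (k + l) = toPt ε k + toPt ε l := by
  funext i; simp [toPt, mul_add]

theorem toPt_zdir (ε : ℝ) (e : Fin d × Bool) : toPt ε (zdir e) = ε • sdir d e := by
  funext i
  by_cases h : i = e.1
  · subst h; cases h2 : e.2 <;> simp [toPt, zdir, sdir, h2]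
  · simp [toPt, zdir, sdir, h]

theorem norm_toPt_zdir {ε : ℝ} (hε : 0 < ε) (e : Fin d × Bool) : ‖toPt ε (zdir e)‖ = ε := by
  rw [toPt_zdir, norm_smul, sdir, Pi.norm_single]
  cases e.2 <;> simp [abs_of_pos hε]

theorem nablaList_toPt (ε : ℝ) (es : List (Fin d × Bool)) (f : Pt d → ℝ) (k : Idx d) :
    nablaList ε es f (toPt ε k) = znL ε es (fun l => f (toPt ε l)) k := by
  induction es generalizing k with
  | nil => rfl
  | cons e es ih =>
    simp only [nablaList, znL, nabla, zn]
    rw [← toPt_zdir, ← toPt_add, ih, ih]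

theorem latLap_toPt (ε : ℝ) (f : Pt d → ℝ) (k : Idx d) :
    latLap ε f (toPt ε k) = zlap ε (fun l => f (toPt ε l)) k := by
  have h1 : ∀ μ : Fin d, ε • (Pi.single μ 1 : Pt d) = toPt ε (zdir (μ, true)) := by
    intro μ; rw [toPt_zdir]; simp [sdir]
  have h2 : ∀ μ : Fin d, toPt ε (zdir (μ, true)) = - toPt ε (zdir (μ, false)) := by
    intro μ; rw [toPt_zdir, toPt_zdir]; simp [sdir, Pi.single_neg]
  simp only [latLap, zlap, zn]
  rw [← Finset.mul_sum, ← mul_assoc, ← pow_two, Fintype.sum_prod_type]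
  congr 1
  refine Finset.sum_congr rfl fun μ _ => ?_
  rw [h1, Fintype.sum_bool, toPt_add, toPt_add]
  nth_rewrite 2 [h2]
  rw [sub_neg_eq_add]
  ring

theorem zn_comm (ε : ℝ) (e e' : Fin d × Bool) (u : Idx d → ℝ) :
    zn ε e (zn ε e' u) = zn ε e' (zn ε e u) := by
  funext k
  simp only [zn]
  rw [add_right_comm]
  ring

theorem zn_zlap (ε : ℝ) (e : Fin d × Bool) (u : Idx d → ℝ) :
    zn ε e (zlap ε u) = zlap ε (zn ε e u) := by
  funext k
  have : zlap ε (zn ε e u) k = ε⁻¹ * ∑ e', zn ε e (zn ε e' u) k := by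
    simp only [zlap]
    congr 1
    exact Finset.sum_congr rfl fun e' _ => by rw [zn_comm]
  rw [this]
  simp only [zn, zlap]
  simp only [← Finset.mul_sum, Finset.sum_sub_distrib]
  ring

/-- The equation passes to iterated derivatives. -/
theorem eq_znL (ε a : ℝ) (h G : Idx d → ℝ) (hG : ∀ k, a * h k - zlap ε h k = G k)
    (es : List (Fin d × Bool)) :
    ∀ k, a * znL ε es h k - zlap ε (znL ε es h) k = znL ε es G k := by
  induction es with
  | nil => exact hG
  | cons e es ih =>
    intro k
    simp only [znL]
    rw [← zn_zlap]
    simp only [zn]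
    rw [← ih, ← ih]
    ring

/-! ### Finite support -/

theorem FS.summable {u : Idx d → ℝ} (h : FS u) : Summable u :=
  summable_of_hasFiniteSupport h

theorem FS.mono {u v : Idx d → ℝ} (h : FS u) (hv : ∀ k, u k = 0 → v k = 0) : FS v :=
  Set.Finite.subset h fun k hk hu => hk (hv k hu)

theorem FS.mono2 {u w v : Idx d → ℝ} (h : FS u) (h' : FS w)
    (hv : ∀ k, u k = 0 → w k = 0 → v k = 0) : FS v :=
  Set.Finite.subset (h.union h') fun k hk => by
    by_contra hc
    simp only [Set.mem_union, Function.mem_support, not_or, not_not] at hc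
    exact hk (hv k hc.1 hc.2)

theorem FS.shift {u : Idx d → ℝ} (h : FS u) (z : Idx d) : FS (fun k => u (k + z)) := by
  have : Function.support (fun k => u (k + z)) = (fun k => k + z) ⁻¹' Function.support u := rfl
  unfold FS
  rw [this]
  exact Set.Finite.preimage (fun a _ b _ hab => by simpa using hab) h

theorem FS.zn {u : Idx d → ℝ} (h : FS u) (ε : ℝ) (e : Fin d × Bool) : FS (zn ε e u) :=
  h.mono2 (h.shift (zdir e)) fun k h1 h2 => by simp only [FRD.zn]; rw [h1, h2]; simp

theorem FS.znL {u : Idx d → ℝ} (h : FS u) (ε : ℝ) (es : List (Fin d × Bool)) :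
    FS (znL ε es u) := by
  induction es with
  | nil => exact h
  | cons e es ih => exact ih.zn ε e

theorem FS.zlap {u : Idx d → ℝ} (h : FS u) (ε : ℝ) : FS (zlap ε u) := by
  have h1 : (⋃ e : Fin d × Bool, Function.support (FRD.zn ε e u)).Finite :=
    Set.finite_iUnion fun e => h.zn ε e
  refine h1.subset fun k hk => ?_
  by_contra hc
  simp only [Set.mem_iUnion, Function.mem_support, not_exists, not_not] at hc
  exact hk (by simp [FRD.zlap, hc])

theorem tsum_shift (u : Idx d → ℝ) (z : Idx d) : ∑' k, u (k + z) = ∑' k, u k :=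
  (Equiv.addRight z).tsum_eq u

/-! ### Summation by parts -/

/-- Opposite direction. -/
def ne' (e : Fin d × Bool) : Fin d × Bool := (e.1, !e.2)

theorem ne'_invol : Function.Involutive (ne' (d := d)) := fun e => by simp [ne']

theorem zdir_ne (e : Fin d × Bool) : zdir (ne' e) = - zdir e := by
  rcases e with ⟨i, b⟩
  cases b <;> simp [zdir, ne', Pi.single_neg]

theorem zn_ne (ε : ℝ) (e : Fin d × Bool) (u : Idx d → ℝ) (k : Idx d) :
    zn ε (ne' e) u (k + zdir e) = - zn ε e u k := by
  simp only [zn, zdir_ne, add_neg_cancel_right]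
  ring

theorem sbp_one (ε : ℝ) (e : Fin d × Bool) (u v : Idx d → ℝ) (hv : FS v) :
    ∑' k, zn ε e u k * zn ε e v k =
      - ε⁻¹ * ∑' k, v k * zn ε (ne' e) u k - ε⁻¹ * ∑' k, v k * zn ε e u k := by
  have s1 : FS (fun k => v k * zn ε (ne' e) u k) := hv.mono fun k hk => by rw [hk, zero_mul]
  have s2 : FS (fun k => v k * zn ε e u k) := hv.mono fun k hk => by rw [hk, zero_mul]
  rw [← tsum_shift (fun k => v k * zn ε (ne' e) u k) (zdir e), ← tsum_mul_left, ← tsum_mul_left,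
    ← Summable.tsum_sub ((s1.shift (zdir e)).summable.mul_left _) (s2.summable.mul_left _)]
  refine tsum_congr fun k => ?_
  rw [zn_ne]
  simp only [zn]
  ring

theorem sbp (ε : ℝ) (u v : Idx d → ℝ) (hv : FS v) :
    ∑ e : Fin d × Bool, ∑' k, zn ε e u k * zn ε e v k = - 2 * ∑' k, v k * zlap ε u k := by
  have h1 : ∑' k, v k * zlap ε u k = ε⁻¹ * ∑ e : Fin d × Bool, ∑' k, v k * zn ε e u k := by
    rw [← Summable.tsum_finsetSum (fun e _ => FS.summable
      (hv.mono fun k hk => by rw [hk, zero_mul])), ← tsum_mul_left]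
    refine tsum_congr fun k => ?_
    simp only [zlap]
    rw [← Finset.mul_sum]
    ring
  have h2 : ∑ e : Fin d × Bool, ∑' k, v k * zn ε (ne' e) u k
      = ∑ e : Fin d × Bool, ∑' k, v k * zn ε e u k :=
    (Equiv.sum_comp (Function.Involutive.toPerm ne' ne'_invol)
      (fun e => ∑' k, v k * zn ε e u k))
  simp only [sbp_one ε _ u v hv]
  rw [Finset.sum_sub_distrib, ← Finset.mul_sum, ← Finset.mul_sum, h2, h1]
  ring

/-- Weighted energy inequality. -/
theorem energy (ε a : ℝ) (ha : 0 ≤ a) (u F χ : Idx d → ℝ) (hu : FS u)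
    (heq : ∀ k, a * u k - zlap ε u k = F k) :
    ∑ e : Fin d × Bool, ∑' k, zn ε e u k * zn ε e (fun l => χ l ^ 2 * u l) k
      ≤ 2 * ∑' k, χ k ^ 2 * u k * F k := by
  have hv : FS (fun l => χ l ^ 2 * u l) := hu.mono fun k hk => by rw [hk, mul_zero]
  rw [sbp ε u _ hv, ← tsum_mul_left, ← tsum_mul_left]
  refine Summable.tsum_le_tsum (fun k => ?_) (FS.summable ?_) (FS.summable ?_)
  · rw [← heq k]
    have : 0 ≤ a * (χ k * u k) ^ 2 := by positivity
    nlinarith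
  · exact hu.mono fun k hk => by rw [hk]; simp
  · exact hu.mono fun k hk => by rw [hk]; simp

/-! ### Poincare inequality -/

theorem poincare (ε R : ℝ) (hε : 0 < ε) (hεR : ε ≤ R / 2) (u : Idx d → ℝ) (hu : FS u) (i : Fin d)
    (hsupp : ∀ k, u k ≠ 0 → |ε * (k i : ℝ)| < R / 2) :
    ∑' k, u k ^ 2 ≤ 4 * R ^ 2 * ∑' k, zn ε (i, true) u k ^ 2 := by
  set e : Fin d × Bool := (i, true) with he
  have hu2 : FS (fun k => u k ^ 2) := hu.mono fun k hk => by rw [hk]; simp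
  have hW : FS (fun k => (k i : ℝ) * u k ^ 2) := hu.mono fun k hk => by rw [hk]; simp
  have hD : FS (fun k => zn ε e u k ^ 2) := (hu.zn ε e).mono fun k hk => by rw [hk]; simp
  have hzi : ∀ k : Idx d, (((k + zdir e) i : ℤ) : ℝ) = k i + 1 := by
    intro k; simp [zdir, he]
  have key : ∀ k : Idx d, u (k + zdir e) ^ 2 ≤
      ((((k + zdir e) i : ℤ) : ℝ) * u (k + zdir e) ^ 2 - (k i : ℝ) * u k ^ 2)
      + (2 * R ^ 2 * zn ε e u k ^ 2 + ((1/4) * u k ^ 2 + (1/4) * u (k + zdir e) ^ 2)) := by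
    intro k
    rw [hzi]
    have hD' : u (k + zdir e) - u k = ε * zn ε e u k := by
      simp only [zn]; field_simp
    by_cases h0 : u k = 0 ∧ u (k + zdir e) = 0
    · rw [h0.1, h0.2]
      have : 0 ≤ 2 * R ^ 2 * zn ε e u k ^ 2 := by positivity
      linarith
    · have hb : |ε * (k i : ℝ)| ≤ R := by
        by_cases h1 : u k = 0
        · have h2 : u (k + zdir e) ≠ 0 := fun h => h0 ⟨h1, h⟩
          have h3 := hsupp _ h2
          rw [hzi] at h3
          rw [abs_lt] at h3
          rw [abs_le]
          constructor <;> nlinarith [h3.1, h3.2]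
        · have h3 := hsupp _ h1
          linarith [abs_nonneg (ε * (k i : ℝ))]
      have hb2 : (ε * (k i : ℝ)) ^ 2 ≤ R ^ 2 := sq_le_sq' (abs_le.1 hb).1 (abs_le.1 hb).2
      generalize zn ε e u k = D at *
      generalize u (k + zdir e) = u' at *
      generalize u k = v at *
      generalize (k i : ℝ) = n at *
      have e1 : (n + 1) * u' ^ 2 - n * v ^ 2 = u' ^ 2 + (ε * n) * D * (u' + v) := by
        have : (ε * n) * D * (u' + v) = n * (u' - v) * (u' + v) := by rw [hD']; ring
        rw [this]; ring
      rw [e1]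
      have e2 : (ε * n) ^ 2 * D ^ 2 ≤ R ^ 2 * D ^ 2 :=
        mul_le_mul_of_nonneg_right hb2 (sq_nonneg _)
      nlinarith [sq_nonneg (4 * (ε * n * D) + (u' + v)), sq_nonneg (u' - v)]
  have hsum := Summable.tsum_le_tsum key (hu2.shift (zdir e)).summable
    (((hW.shift (zdir e)).summable.sub hW.summable).add
      ((hD.summable.mul_left _).add ((hu2.summable.mul_left _).add
        ((hu2.shift (zdir e)).summable.mul_left _))))
  rw [Summable.tsum_add ((hW.shift (zdir e)).summable.sub hW.summable)
      ((hD.summable.mul_left _).add ((hu2.summable.mul_left _).add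
        ((hu2.shift (zdir e)).summable.mul_left _))),
    Summable.tsum_add (hD.summable.mul_left _) ((hu2.summable.mul_left _).add
        ((hu2.shift (zdir e)).summable.mul_left _)),
    Summable.tsum_add (hu2.summable.mul_left _) ((hu2.shift (zdir e)).summable.mul_left _),
    Summable.tsum_sub (hW.shift (zdir e)).summable hW.summable,
    tsum_mul_left, tsum_mul_left, tsum_mul_left,
    tsum_shift (fun k => u k ^ 2) (zdir e), tsum_shift (fun k => (k i : ℝ) * u k ^ 2) (zdir e)]
    at hsum
  linarith

/-! ### Local square sums -/

/-- Index ball. -/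
def B (d : ℕ) (ε ρ : ℝ) : Set (Idx d) := {k | ‖toPt ε k‖ < ρ}

/-- Local sum of squares. -/
noncomputable def N (ε ρ : ℝ) (u : Idx d → ℝ) : ℝ := ∑' k, (B d ε ρ).indicator (fun k => u k ^ 2) k

theorem FS.ind {u : Idx d → ℝ} (h : FS u) (ε ρ : ℝ) :
    FS ((B d ε ρ).indicator (fun k => u k ^ 2)) :=
  h.mono fun k hk => by simp [Set.indicator, hk]

theorem N_nonneg (ε ρ : ℝ) (u : Idx d → ℝ) : 0 ≤ N ε ρ u :=
  tsum_nonneg fun k => Set.indicator_nonneg (fun _ _ => sq_nonneg _) k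

theorem N_le_tsum (ε ρ : ℝ) (u : Idx d → ℝ) (hu : FS u) : N ε ρ u ≤ ∑' k, u k ^ 2 :=
  Summable.tsum_le_tsum (fun k => Set.indicator_le_self' (fun _ _ => sq_nonneg _) k)
    (hu.ind ε ρ).summable (FS.summable (hu.mono fun k hk => by rw [hk]; simp))

theorem B_finite {ε : ℝ} (hε : 0 < ε) (ρ : ℝ) : (B d ε ρ).Finite := by
  obtain ⟨n, hn⟩ := exists_nat_gt (ρ / ε)
  refine (Set.finite_Icc (fun _ => -(n : ℤ) : Idx d) (fun _ => (n : ℤ))).subset fun k hk => ?_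
  have h1 : ∀ i, |(k i : ℝ)| ≤ n := by
    intro i
    have h2 : |ε * (k i : ℝ)| < ρ := lt_of_le_of_lt (norm_le_pi_norm (toPt ε k) i) hk
    rw [abs_mul, abs_of_pos hε] at h2
    have h3 : |(k i : ℝ)| < ρ / ε := by rw [lt_div_iff₀ hε]; linarith
    linarith
  constructor <;> intro i
  · have := (abs_le.1 (h1 i)).1
    exact_mod_cast this
  · have := (abs_le.1 (h1 i)).2
    exact_mod_cast this

theorem FS_ind {ε : ℝ} (hε : 0 < ε) (ρ : ℝ) (u : Idx d → ℝ) : FS ((B d ε ρ).indicator u) :=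
  (B_finite hε ρ).subset fun k hk => by
    by_contra hc
    exact hk (Set.indicator_of_notMem hc _)

/-- Cutoff. -/
noncomputable def cut (ε ρ δ : ℝ) (k : Idx d) : ℝ := max 0 (min 1 ((ρ + δ - ‖toPt ε k‖) / δ))

theorem cut_nonneg (ε ρ δ : ℝ) (k : Idx d) : 0 ≤ cut ε ρ δ k := le_max_left _ _

theorem cut_le_one (ε ρ δ : ℝ) (k : Idx d) : cut ε ρ δ k ≤ 1 :=
  max_le zero_le_one (min_le_left _ _)

theorem cut_eq_one {ε ρ δ : ℝ} (hδ : 0 < δ) {k : Idx d} (hk : k ∈ B d ε ρ) :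
    cut ε ρ δ k = 1 := by
  have hk' : ‖toPt ε k‖ < ρ := hk
  have : 1 ≤ (ρ + δ - ‖toPt ε k‖) / δ := by rw [le_div_iff₀ hδ]; linarith
  simp [cut, min_eq_left this]

theorem cut_eq_zero {ε ρ δ : ℝ} (hδ : 0 < δ) {k : Idx d} (hk : ρ + δ ≤ ‖toPt ε k‖) :
    cut ε ρ δ k = 0 := by
  have : (ρ + δ - ‖toPt ε k‖) / δ ≤ 0 := div_nonpos_of_nonpos_of_nonneg (by linarith) hδ.le
  exact max_eq_left ((min_le_right _ _).trans this)

theorem norm_shift {ε : ℝ} (hε : 0 < ε) (e : Fin d × Bool) (k : Idx d) :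
    |‖toPt ε (k + zdir e)‖ - ‖toPt ε k‖| ≤ ε := by
  have := abs_norm_sub_norm_le (toPt ε (k + zdir e)) (toPt ε k)
  rw [toPt_add] at this ⊢
  rwa [add_sub_cancel_left, norm_toPt_zdir hε] at this

theorem zn_cut_sq {ε ρ δ : ℝ} (hε : 0 < ε) (hδ : 0 < δ) (e : Fin d × Bool) (k : Idx d) :
    zn ε e (cut ε ρ δ) k ^ 2 ≤ (δ⁻¹) ^ 2 := by
  have h1 : |cut ε ρ δ (k + zdir e) - cut ε ρ δ k| ≤ ε / δ := by
    have h2 : |cut ε ρ δ (k + zdir e) - cut ε ρ δ k| ≤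
        |(ρ + δ - ‖toPt ε (k + zdir e)‖) / δ - (ρ + δ - ‖toPt ε k‖) / δ| := by
      unfold cut
      refine (abs_max_sub_max_le_max _ _ _ _).trans (max_le (by simp) ?_)
      refine (abs_min_sub_min_le_max _ _ _ _).trans (max_le (by simp) le_rfl)
    refine h2.trans ?_
    rw [← sub_div, abs_div, abs_of_pos hδ]
    gcongr
    have := norm_shift hε e k
    rw [abs_sub_comm] at this
    rw [abs_sub_comm] at this
    rw [abs_sub_comm]
    rwa [sub_sub_sub_cancel_left]
  have h3 : |zn ε e (cut ε ρ δ) k| ≤ δ⁻¹ := by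
    simp only [zn]
    rw [abs_mul, abs_of_pos (inv_pos.2 hε)]
    calc ε⁻¹ * |cut ε ρ δ (k + zdir e) - cut ε ρ δ k| ≤ ε⁻¹ * (ε / δ) := by gcongr
      _ = δ⁻¹ := by field_simp
  exact sq_le_sq' (abs_le.1 h3).1 (abs_le.1 h3).2

/-- Pointwise bond inequality behind Caccioppoli. -/
theorem bond (i c c' v v' : ℝ) :
    c ^ 2 * (i * (v' - v)) ^ 2 ≤ 4 * ((i * (v' - v)) * (i * (c' ^ 2 * v' - c ^ 2 * v)))
      + 4 * ((i * (c' - c)) ^ 2 * v ^ 2 + (i * (c' - c)) ^ 2 * v' ^ 2) := by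
  have h : c ^ 2 * (v' - v) ^ 2 ≤ 4 * ((v' - v) * (c' ^ 2 * v' - c ^ 2 * v))
      + 4 * ((c' - c) ^ 2 * v ^ 2 + (c' - c) ^ 2 * v' ^ 2) := by
    nlinarith [sq_nonneg ((c' + c) * (v' - v) / 2 + (c' - c) * (v + v')),
      sq_nonneg ((c' - c) * (v - v')), sq_nonneg ((c' - c) * (v' - v)), sq_nonneg (c' * (v' - v))]
  have := mul_le_mul_of_nonneg_left h (sq_nonneg i)
  linarith

/-- Interior (Caccioppoli) step. -/
theorem cacc {ε a ρ δ : ℝ} (hε : 0 < ε) (hεδ : ε ≤ δ) (ha : 0 ≤ a) (u F : Idx d → ℝ)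
    (hu : FS u) (hF : FS F) (heq : ∀ k, a * u k - zlap ε u k = F k) (e₀ : Fin d × Bool) :
    N ε ρ (zn ε e₀ u) ≤ (4 + 16 * d * (δ⁻¹) ^ 2) *
      (N ε (ρ + 2 * δ) u + N ε (ρ + 2 * δ) F) := by
  have hδ : 0 < δ := hε.trans_le hεδ
  set χ : Idx d → ℝ := cut ε ρ δ with hχ
  set ρ' := ρ + 2 * δ with hρ'
  set v : Idx d → ℝ := fun l => χ l ^ 2 * u l with hv
  have hvF : FS v := hu.mono fun k hk => by simp [hv, hk]
  -- the integrand
  have hS1 : ∀ e, FS (fun k => χ k ^ 2 * zn ε e u k ^ 2) := fun e =>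
    (hu.zn ε e).mono fun k hk => by rw [hk]; simp
  have hS2 : ∀ e, FS (fun k => zn ε e u k * zn ε e v k) := fun e =>
    (hu.zn ε e).mono fun k hk => by rw [hk]; simp
  have hI := hu.ind ε ρ'
  have hIF := hF.ind ε ρ'
  have step1 : N ε ρ (zn ε e₀ u) ≤ ∑' k, χ k ^ 2 * zn ε e₀ u k ^ 2 := by
    refine Summable.tsum_le_tsum (fun k => ?_) ((hu.zn ε e₀).ind ε ρ).summable (hS1 e₀).summable
    by_cases hk : k ∈ B d ε ρ
    · rw [Set.indicator_of_mem hk, hχ, cut_eq_one hδ hk]; simp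
    · rw [Set.indicator_of_notMem hk]; positivity
  have step2 : ∑' k, χ k ^ 2 * zn ε e₀ u k ^ 2 ≤
      ∑ e : Fin d × Bool, ∑' k, χ k ^ 2 * zn ε e u k ^ 2 :=
    Finset.single_le_sum (f := fun e => ∑' k, χ k ^ 2 * zn ε e u k ^ 2)
      (fun e _ => tsum_nonneg fun k => by positivity) (Finset.mem_univ e₀)
  have inB : ∀ k : Idx d, ‖toPt ε k‖ < ρ + δ → k ∈ B d ε ρ' := fun k hk => by
    change ‖toPt ε k‖ < ρ'
    linarith
  have step3 : ∀ e : Fin d × Bool, ∑' k, χ k ^ 2 * zn ε e u k ^ 2 ≤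
      4 * ∑' k, zn ε e u k * zn ε e v k + 8 * (δ⁻¹) ^ 2 * N ε ρ' u := by
    intro e
    have hsh := hI.shift (zdir e)
    have h1 : ∀ k, χ k ^ 2 * zn ε e u k ^ 2 ≤ 4 * (zn ε e u k * zn ε e v k) +
        (4 * (δ⁻¹) ^ 2 * (B d ε ρ').indicator (fun k => u k ^ 2) k +
        4 * (δ⁻¹) ^ 2 * (B d ε ρ').indicator (fun k => u k ^ 2) (k + zdir e)) := by
      intro k
      have hb := bond ε⁻¹ (χ k) (χ (k + zdir e)) (u k) (u (k + zdir e))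
      have hc : zn ε e χ k ^ 2 ≤ (δ⁻¹) ^ 2 := zn_cut_sq hε hδ e k
      have hn := abs_le.1 (norm_shift hε e k)
      by_cases h0 : ρ + δ ≤ ‖toPt ε k‖ ∧ ρ + δ ≤ ‖toPt ε (k + zdir e)‖
      · have c1 : χ k = 0 := cut_eq_zero hδ h0.1
        have c2 : χ (k + zdir e) = 0 := cut_eq_zero hδ h0.2
        have i1 : 0 ≤ (B d ε ρ').indicator (fun k => u k ^ 2) k :=
          Set.indicator_nonneg (fun _ _ => sq_nonneg _) k
        have i2 : 0 ≤ (B d ε ρ').indicator (fun k => u k ^ 2) (k + zdir e) :=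
          Set.indicator_nonneg (fun _ _ => sq_nonneg _) _
        have : zn ε e v k = 0 := by simp [zn, hv, c1, c2]
        rw [this, c1]
        simp only [ne_eq, OfNat.ofNat_ne_zero, not_false_eq_true, zero_pow, zero_mul, mul_zero,
          zero_add]
        positivity
      · have hlt : ‖toPt ε k‖ < ρ' ∧ ‖toPt ε (k + zdir e)‖ < ρ' := by
          by_cases h1 : ρ + δ ≤ ‖toPt ε k‖
          · have h2 : ‖toPt ε (k + zdir e)‖ < ρ + δ := by
              by_contra h; exact h0 ⟨h1, not_lt.1 h⟩
            constructor <;> linarith [hn.1, hn.2]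
          · push Not at h1
            constructor <;> linarith [hn.1, hn.2]
        rw [Set.indicator_of_mem (show k ∈ B d ε ρ' from hlt.1),
          Set.indicator_of_mem (show k + zdir e ∈ B d ε ρ' from hlt.2)]
        have m1 := mul_le_mul_of_nonneg_right hc (sq_nonneg (u k))
        have m2 := mul_le_mul_of_nonneg_right hc (sq_nonneg (u (k + zdir e)))
        simp only [zn, hv] at hb m1 m2 ⊢
        linarith
    have hs := Summable.tsum_le_tsum h1 (hS1 e).summable
      (((hS2 e).summable.mul_left _).add ((hI.summable.mul_left _).add (hsh.summable.mul_left _)))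
    rw [Summable.tsum_add ((hS2 e).summable.mul_left _)
        ((hI.summable.mul_left _).add (hsh.summable.mul_left _)),
      Summable.tsum_add (hI.summable.mul_left _) (hsh.summable.mul_left _),
      tsum_mul_left, tsum_mul_left, tsum_mul_left,
      tsum_shift ((B d ε ρ').indicator (fun k => u k ^ 2)) (zdir e)] at hs
    simp only [N]
    linarith
  have step4 := energy ε a ha u F χ hu heq
  have step5 : 2 * ∑' k, χ k ^ 2 * u k * F k ≤ N ε ρ' u + N ε ρ' F := by
    rw [← tsum_mul_left, N, N, ← Summable.tsum_add hI.summable hIF.summable]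
    refine Summable.tsum_le_tsum (fun k => ?_)
      (FS.summable (hu.mono fun k hk => by rw [hk]; simp)) (hI.summable.add hIF.summable)
    by_cases hk : ρ + δ ≤ ‖toPt ε k‖
    · have c1 : χ k = 0 := cut_eq_zero hδ hk
      rw [c1]
      have i1 : 0 ≤ (B d ε ρ').indicator (fun k => u k ^ 2) k :=
          Set.indicator_nonneg (fun _ _ => sq_nonneg _) k
      have i2 : 0 ≤ (B d ε ρ').indicator (fun k => F k ^ 2) k :=
          Set.indicator_nonneg (fun _ _ => sq_nonneg _) k
      simp only [ne_eq, OfNat.ofNat_ne_zero, not_false_eq_true, zero_pow, zero_mul, mul_zero]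
      positivity
    · push Not at hk
      rw [Set.indicator_of_mem (inB k hk), Set.indicator_of_mem (inB k hk)]
      have c0 : 0 ≤ χ k := cut_nonneg _ _ _ _
      have c1 : χ k ≤ 1 := cut_le_one _ _ _ _
      have c2 : χ k ^ 2 ≤ 1 := pow_le_one₀ c0 c1
      nlinarith [mul_nonneg (sq_nonneg (χ k)) (sq_nonneg (u k - F k)),
        mul_nonneg (sub_nonneg.2 c2) (add_nonneg (sq_nonneg (u k)) (sq_nonneg (F k)))]
  have step6 : ∑ e : Fin d × Bool, ∑' k, χ k ^ 2 * zn ε e u k ^ 2 ≤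
      4 * (∑ e : Fin d × Bool, ∑' k, zn ε e u k * zn ε e v k)
        + 16 * d * (δ⁻¹) ^ 2 * N ε ρ' u := by
    refine (Finset.sum_le_sum fun e _ => step3 e).trans (le_of_eq ?_)
    rw [Finset.sum_add_distrib, ← Finset.mul_sum, Finset.sum_const, nsmul_eq_mul]
    simp only [Finset.card_univ, Fintype.card_prod, Fintype.card_fin, Fintype.card_bool]
    push_cast
    ring
  have p1 := N_nonneg ε ρ' u
  have p2 := N_nonneg ε ρ' F
  have p3 : 0 ≤ 16 * d * (δ⁻¹) ^ 2 * N ε ρ' F := by positivity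
  simp only [← hv] at step4
  linarith

/-- Iterated interior estimate. -/
theorem iterate {ε a δ r M : ℝ} {k : ℕ} (hε : 0 < ε) (hεδ : ε ≤ δ) (ha : 0 ≤ a)
    (h G : Idx d → ℝ) (hh : FS h) (hG : FS G) (heq : ∀ k, a * h k - zlap ε h k = G k)
    (hM : ∑' k, h k ^ 2 ≤ M)
    (hMG : ∀ es : List (Fin d × Bool), es.length < k → ∀ ρ ≤ r + 2 * δ * k,
      N ε ρ (znL ε es G) ≤ M)
    (es : List (Fin d × Bool)) (hes : es.length ≤ k) :
    N ε (r + 2 * δ * (k - es.length)) (znL ε es h) ≤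
      (2 * (4 + 16 * d * (δ⁻¹) ^ 2)) ^ es.length * M := by
  have hδ : 0 < δ := hε.trans_le hεδ
  have hM0 : 0 ≤ M := (tsum_nonneg fun k => sq_nonneg _).trans hM
  induction es with
  | nil =>
    simp only [List.length_nil, pow_zero, one_mul]
    exact (N_le_tsum _ _ _ (hh.znL ε [])).trans hM
  | cons e es ih =>
    simp only [List.length_cons] at hes ⊢
    have ih' := ih (by omega)
    have hc := cacc (ρ := r + 2 * δ * (k - (es.length + 1 : ℕ))) hε hεδ ha (znL ε es h)
      (znL ε es G) (hh.znL ε es) (hG.znL ε es) (eq_znL ε a h G heq es) e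
    have e1 : r + 2 * δ * (k - (es.length + 1 : ℕ)) + 2 * δ = r + 2 * δ * (k - es.length) := by
      push_cast; ring
    rw [e1] at hc
    have hg := hMG es (by omega) (r + 2 * δ * (k - es.length)) (by
      have : 0 ≤ δ * (es.length : ℝ) := by positivity
      nlinarith)
    set K : ℝ := 4 + 16 * d * (δ⁻¹) ^ 2 with hK
    have hK1 : 1 ≤ 2 * K := by
      have : 0 ≤ 16 * (d : ℝ) * (δ⁻¹) ^ 2 := by positivity
      rw [hK]; linarith
    have hK0 : 0 ≤ K := by linarith
    have hp : 1 ≤ (2 * K) ^ es.length := one_le_pow₀ hK1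
    calc _ ≤ K * (N ε (r + 2 * δ * (k - es.length)) (znL ε es h)
            + N ε (r + 2 * δ * (k - es.length)) (znL ε es G)) := hc
      _ ≤ K * ((2 * K) ^ es.length * M + (2 * K) ^ es.length * M) := by
          gcongr
          exact hg.trans (le_mul_of_one_le_left hM0 hp)
      _ = (2 * K) ^ (es.length + 1) * M := by ring

/-- Global `L²` bound. -/
theorem global {ε a R : ℝ} (hd : 1 ≤ d) (hε : 0 < ε) (hεR : ε ≤ R / 2) (ha : 0 ≤ a)
    (h G : Idx d → ℝ) (hh : FS h) (hG : FS G) (heq : ∀ k, a * h k - zlap ε h k = G k)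
    (hsupp : ∀ k, h k ≠ 0 → ‖toPt ε k‖ < R / 2) :
    ∑' k, h k ^ 2 ≤ 64 * R ^ 4 * N ε (R / 2) G := by
  have i : Fin d := ⟨0, hd⟩
  have hP := poincare ε R hε hεR h hh i fun k hk =>
    lt_of_le_of_lt (norm_le_pi_norm (toPt ε k) i) (hsupp k hk)
  have hE := energy ε a ha h G (fun _ => 1) hh heq
  simp only [one_pow, one_mul, ← pow_two] at hE
  have h1 : ∑' k, zn ε (i, true) h k ^ 2 ≤ ∑ e : Fin d × Bool, ∑' k, zn ε e h k ^ 2 :=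
    Finset.single_le_sum (f := fun e => ∑' k, zn ε e h k ^ 2)
      (fun e _ => tsum_nonneg fun k => by positivity) (Finset.mem_univ (i, true))
  have hh2 : FS (fun k => h k ^ 2) := hh.mono fun k hk => by rw [hk]; simp
  have h2 : 8 * R ^ 2 * ∑' k, h k * G k ≤
      (1/2) * ∑' k, h k ^ 2 + 32 * R ^ 4 * N ε (R / 2) G := by
    rw [N, ← tsum_mul_left, ← tsum_mul_left, ← tsum_mul_left,
      ← Summable.tsum_add (hh2.summable.mul_left _) ((hG.ind ε (R/2)).summable.mul_left _)]
    refine Summable.tsum_le_tsum (fun k => ?_)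
      (FS.summable (hh.mono fun k hk => by rw [hk]; simp))
      ((hh2.summable.mul_left _).add ((hG.ind ε (R/2)).summable.mul_left _))
    by_cases hk : k ∈ B d ε (R / 2)
    · rw [Set.indicator_of_mem hk]
      nlinarith [sq_nonneg (h k - 8 * R ^ 2 * G k)]
    · rw [Set.indicator_of_notMem hk]
      have : h k = 0 := by
        by_contra hc; exact hk (hsupp k hc)
      rw [this]; simp
  have h3 : 4 * R ^ 2 * ∑' k, zn ε (i, true) h k ^ 2 ≤ 4 * R ^ 2 * (2 * ∑' k, h k * G k) := by
    gcongr
    exact h1.trans hE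
  linarith

/-- Locality of iterated derivatives. -/
theorem znL_congr {ε r : ℝ} (hε : 0 < ε) (G g : Idx d → ℝ)
    (hGg : ∀ k, ‖toPt ε k‖ < r → G k = g k) (es : List (Fin d × Bool)) :
    ∀ k, ‖toPt ε k‖ < r - es.length * ε → znL ε es G k = znL ε es g k := by
  induction es with
  | nil => intro k hk; exact hGg k (by simpa using hk)
  | cons e es ih =>
    intro k hk
    simp only [List.length_cons] at hk
    push_cast at hk
    have hn := abs_le.1 (norm_shift hε e k)
    simp only [znL, zn]
    rw [ih k (by linarith), ih (k + zdir e) (by linarith [hn.2])]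

theorem mem_UC_iff {ε R : ℝ} (hR : 0 < R) (k : Idx d) :
    toPt ε k ∈ UC ε (0 : Pt d) R ↔ ‖toPt ε k‖ < R / 2 := by
  rw [pi_norm_lt_iff (half_pos hR)]
  constructor
  · intro h i; simpa using h.1 i
  · intro h; exact ⟨fun i => by simpa using h i, ⟨k, rfl⟩⟩

theorem eint_eq {ε R : ℝ} (hε : 0 < ε) (hR : 0 < R) (g : Pt d → ℝ) (es : List (Fin d × Bool)) :
    eint ε (UC ε (0 : Pt d) R) (fun x => (nablaList ε es g x) ^ 2) =
      ENNReal.ofReal (ε ^ d * N ε (R / 2) (znL ε es (fun l => g (toPt ε l)))) := by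
  rw [N, ← tsum_mul_left, ENNReal.ofReal_tsum_of_nonneg]
  · refine tsum_congr fun k => ?_
    by_cases hk : k ∈ B d ε (R / 2)
    · rw [Set.indicator_of_mem ((mem_UC_iff hR k).2 hk), Set.indicator_of_mem hk]
      simp only [nablaList_toPt]
    · rw [Set.indicator_of_notMem (fun h => hk ((mem_UC_iff hR k).1 h)),
        Set.indicator_of_notMem hk]
      simp
  · intro k
    exact mul_nonneg (by positivity) (Set.indicator_nonneg (fun _ _ => sq_nonneg _) k)
  · exact (FS_ind hε _ _).summable.mul_left _

/-- Lemma A.1, weighted interior regularity with zero boundary data. -/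
theorem weighted_interior_regularity (d k : ℕ) (hd : 1 ≤ d) (hk : 1 ≤ k)
    (R : ℝ) (hR : 0 < R) (φ : Pt d → ℝ) (hφ : ContDiff ℝ (⊤ : ℕ∞) φ) (hφ0 : ∀ x, 0 ≤ φ x)
    (hφsupp : tsupport φ ⊆ cubeC (0 : Pt d) R) :
    ∃ ε₀ C : ℝ, 0 < ε₀ ∧ 0 < C ∧
      ∀ ε : ℝ, 0 < ε → ε ≤ ε₀ → ∀ a : ℝ, 0 ≤ a →
      ∀ h g : Pt d → ℝ,
        (∀ x ∈ latt d ε, x ∉ UC ε (0 : Pt d) R → h x = 0) →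
        (∀ x ∈ UC ε (0 : Pt d) R, a * h x - latLap ε h x = g x) →
        wSobNorm ε k φ h ≤ ENNReal.ofReal C * sobNorm ε (k - 1) (UC ε (0 : Pt d) R) g := by
  classical
  have hball : tsupport φ ⊆ Metric.ball (0 : Pt d) (R / 2) := by
    intro x hx
    rw [mem_ball_zero_iff, pi_norm_lt_iff (half_pos hR)]
    intro i
    simpa using hφsupp hx i
  obtain ⟨r, hrR, hr⟩ := exists_lt_subset_ball (isClosed_tsupport φ) hball
  have hcs : HasCompactSupport φ :=
    Metric.isCompact_of_isClosed_isBounded (isClosed_tsupport φ) (Metric.isBounded_ball.subset hball)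
  obtain ⟨S, hS⟩ := hcs.exists_bound_of_continuous hφ.continuous
  have hφr : ∀ x, r ≤ ‖x‖ → φ x = 0 := by
    intro x hx
    by_contra hc
    have := hr (subset_tsupport φ hc)
    rw [mem_ball_zero_iff] at this
    linarith
  have hS0 : 0 ≤ S := (norm_nonneg _).trans (hS 0)
  have hkR : (1 : ℝ) ≤ k := by exact_mod_cast hk
  set δ : ℝ := (R / 2 - r) / (3 * k) with hδdef
  have hδ : 0 < δ := div_pos (by linarith) (by linarith)
  have hδk : r + 3 * δ * k = R / 2 := by
    rw [hδdef]; field_simp; ring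
  set K : ℝ := 2 * (4 + 16 * d * (δ⁻¹) ^ 2) with hK
  have hK1 : 1 ≤ K := by
    have : 0 ≤ 16 * (d : ℝ) * (δ⁻¹) ^ 2 := by positivity
    rw [hK]; linarith
  set cnt : ℕ := ∑ j ∈ Finset.range (k + 1), Fintype.card (Fin j → Fin d × Bool) with hcnt
  set C1 : ℝ := S * (K ^ k * ((64 * R ^ 4 + 1) * 2 ^ k)) with hC1
  have hC10 : 0 ≤ C1 := by positivity
  refine ⟨min δ (R / 2), Real.sqrt (cnt * C1) + 1, lt_min hδ (half_pos hR), by positivity, ?_⟩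
  intro ε hε hε0 a ha h g hh0 hhg
  have hεδ : ε ≤ δ := hε0.trans (min_le_left _ _)
  have hεR : ε ≤ R / 2 := hε0.trans (min_le_right _ _)
  set T := sobSq ε (k - 1) (UC ε (0 : Pt d) R) g with hT
  suffices hmain : wSobSq ε k φ h ≤ ENNReal.ofReal ((Real.sqrt (cnt * C1) + 1) ^ 2) * T by
    unfold wSobNorm sobNorm
    rw [← hT]
    refine (ENNReal.rpow_le_rpow hmain (by norm_num)).trans (le_of_eq ?_)
    rw [ENNReal.mul_rpow_of_nonneg _ _ (by norm_num), ENNReal.ofReal_pow (by positivity),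
      ← ENNReal.rpow_natCast, ← ENNReal.rpow_mul]
    norm_num
  have hCpos : 0 < (Real.sqrt (cnt * C1) + 1) ^ 2 := by positivity
  by_cases hTtop : T = ⊤
  · rw [hTtop, ENNReal.mul_top (ENNReal.ofReal_pos.2 hCpos).ne']
    exact le_top
  set hz : Idx d → ℝ := fun l => h (toPt ε l) with hhz
  set gz : Idx d → ℝ := fun l => g (toPt ε l) with hgz
  set G : Idx d → ℝ := fun l => a * hz l - zlap ε hz l with hGdef
  have hsupp : ∀ l, hz l ≠ 0 → ‖toPt ε l‖ < R / 2 := by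
    intro l hl
    by_contra hc
    exact hl (hh0 _ ⟨l, rfl⟩ fun hm => hc ((mem_UC_iff hR l).1 hm))
  have hzFS : FS hz := (B_finite hε (R / 2)).subset fun l hl => hsupp l hl
  have hGFS : FS G := hzFS.mono2 (hzFS.zlap ε) fun l h1 h2 => by simp [hGdef, h1, h2]
  have hGg : ∀ l, ‖toPt ε l‖ < R / 2 → G l = gz l := by
    intro l hl
    have := hhg _ ((mem_UC_iff hR l).2 hl)
    rw [latLap_toPt] at this
    exact this
  have hεd : 0 < ε ^ d := by positivity
  have hgT : ∀ es : List (Fin d × Bool), es.length < k →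
      N ε (R / 2) (znL ε es gz) ≤ 2 ^ k * T.toReal / ε ^ d := by
    intro es hes
    rw [le_div_iff₀ hεd, mul_comm]
    have e1 : (2 : ℝ≥0∞)⁻¹ ^ es.length *
        eint ε (UC ε (0 : Pt d) R) (fun x => (nablaList ε es g x) ^ 2) ≤ T := by
      rw [hT, sobSq]
      refine le_trans ?_ (Finset.single_le_sum
        (f := fun j => (2 : ℝ≥0∞)⁻¹ ^ j * ∑ es : Fin j → Fin d × Bool,
          eint ε (UC ε (0 : Pt d) R) fun x => (nablaList ε (List.ofFn es) g x) ^ 2)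
        (fun _ _ => zero_le) (Finset.mem_range.2 (show es.length < k - 1 + 1 by omega)))
      refine mul_le_mul_right ?_ _
      have := Finset.single_le_sum
        (f := fun es : Fin es.length → Fin d × Bool =>
          eint ε (UC ε (0 : Pt d) R) fun x => (nablaList ε (List.ofFn es) g x) ^ 2)
        (fun _ _ => zero_le) (Finset.mem_univ es.get)
      simpa only [List.ofFn_get] using this
    rw [eint_eq hε hR] at e1
    have e2 := ENNReal.toReal_mono hTtop e1
    rw [ENNReal.toReal_mul, ENNReal.toReal_ofReal
      (mul_nonneg hεd.le (N_nonneg _ _ _)), ENNReal.toReal_pow, ENNReal.toReal_inv] at e2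
    simp only [ENNReal.toReal_ofNat] at e2
    rw [inv_pow, inv_mul_le_iff₀ (by positivity)] at e2
    refine e2.trans ?_
    gcongr
    · norm_num
  have hT0 : 0 ≤ T.toReal := ENNReal.toReal_nonneg
  set M : ℝ := (64 * R ^ 4 + 1) * (2 ^ k * T.toReal / ε ^ d) with hM
  have hX0 : 0 ≤ 2 ^ k * T.toReal / ε ^ d := by positivity
  have hNle : ∀ es : List (Fin d × Bool), ∀ ρ ≤ R / 2 - es.length * ε,
      N ε ρ (znL ε es G) ≤ N ε (R / 2) (znL ε es gz) := by
    intro es ρ hρ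
    refine Summable.tsum_le_tsum (fun l => ?_) (FS_ind hε _ _).summable (FS_ind hε _ _).summable
    by_cases hl : l ∈ B d ε ρ
    · have hl' : ‖toPt ε l‖ < ρ := hl
      have : 0 ≤ (es.length : ℝ) * ε := by positivity
      rw [Set.indicator_of_mem hl,
        Set.indicator_of_mem (show l ∈ B d ε (R / 2) from lt_of_lt_of_le hl' (by linarith)),
        znL_congr hε G gz hGg es l (by linarith)]
    · rw [Set.indicator_of_notMem hl]
      exact Set.indicator_nonneg (fun _ _ => sq_nonneg _) _
  have hglob : ∑' l, hz l ^ 2 ≤ M := by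
    have h1 := global hd hε hεR ha hz G hzFS hGFS (fun _ => rfl) hsupp
    have h2 : N ε (R / 2) G ≤ N ε (R / 2) gz := hNle [] (R / 2) (by simp)
    have h3 : N ε (R / 2) gz ≤ _ := hgT [] (by simp; omega)
    have h4 : 64 * R ^ 4 * N ε (R / 2) G ≤ 64 * R ^ 4 * (2 ^ k * T.toReal / ε ^ d) := by
      gcongr
      exact h2.trans h3
    rw [hM]
    linarith
  have hMG : ∀ es : List (Fin d × Bool), es.length < k → ∀ ρ ≤ r + 2 * δ * k,
      N ε ρ (znL ε es G) ≤ M := by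
    intro es hes ρ hρ
    have h1 : (es.length : ℝ) * ε ≤ k * δ := by
      have : (es.length : ℝ) ≤ k := by exact_mod_cast hes.le
      gcongr
    have h2 := (hNle es ρ (by linarith)).trans (hgT es hes)
    have : 0 ≤ 64 * R ^ 4 * (2 ^ k * T.toReal / ε ^ d) := by positivity
    rw [hM]
    linarith
  have hM0 : 0 ≤ M := by positivity
  have hterm : ∀ es : List (Fin d × Bool), es.length ≤ k →
      ∑' l : Idx d, ENNReal.ofReal
        (ε ^ d * φ (toPt ε l) * (nablaList ε es h (toPt ε l)) ^ 2) ≤ ENNReal.ofReal C1 * T := by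
    intro es hes
    have hit := iterate hε hεδ ha hz G hzFS hGFS (fun _ => rfl) hglob hMG es hes
    set ρ := r + 2 * δ * (k - es.length) with hρ
    have hrρ : r ≤ ρ := by
      have : (es.length : ℝ) ≤ k := by exact_mod_cast hes
      have : 0 ≤ 2 * δ * (k - es.length) := mul_nonneg (by positivity) (by linarith)
      linarith
    have e1 : ∑' l : Idx d, ENNReal.ofReal
        (ε ^ d * φ (toPt ε l) * (nablaList ε es h (toPt ε l)) ^ 2) ≤
        ENNReal.ofReal (ε ^ d * S * N ε ρ (znL ε es hz)) := by
      rw [N, ← tsum_mul_left, ENNReal.ofReal_tsum_of_nonneg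
        (f := fun l => ε ^ d * S * (B d ε ρ).indicator (fun l => znL ε es hz l ^ 2) l)
        (fun l => mul_nonneg (by positivity) (Set.indicator_nonneg (fun _ _ => sq_nonneg _) l))
        ((FS_ind hε _ _).summable.mul_left _)]
      refine ENNReal.tsum_le_tsum fun l => ENNReal.ofReal_le_ofReal ?_
      rw [nablaList_toPt]
      by_cases hl : l ∈ B d ε ρ
      · rw [Set.indicator_of_mem hl]
        have : φ (toPt ε l) ≤ S := (le_abs_self _).trans (hS _)
        gcongr
      · rw [Set.indicator_of_notMem hl, hφr _ (hrρ.trans (not_lt.1 hl))]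
        simp
    refine e1.trans ?_
    rw [← ENNReal.ofReal_toReal hTtop, ← ENNReal.ofReal_mul hC10]
    refine ENNReal.ofReal_le_ofReal ?_
    have hpow : K ^ es.length ≤ K ^ k := pow_le_pow_right₀ hK1 hes
    calc ε ^ d * S * N ε ρ (znL ε es hz) ≤ ε ^ d * S * (K ^ es.length * M) := by gcongr
      _ ≤ ε ^ d * S * (K ^ k * M) := by gcongr
      _ = C1 * T.toReal := by
        rw [hM, hC1]; field_simp
  unfold wSobSq
  calc _ ≤ ∑ j ∈ Finset.range (k + 1), ∑ es : Fin j → Fin d × Bool, ENNReal.ofReal C1 * T := by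
        refine Finset.sum_le_sum fun j hj => ?_
        have h1 : (2 : ℝ≥0∞)⁻¹ ^ j ≤ 1 := pow_le_one₀ zero_le (by norm_num)
        refine (mul_le_of_le_one_left zero_le h1).trans (Finset.sum_le_sum fun es _ => ?_)
        refine hterm (List.ofFn es) ?_
        rw [List.length_ofFn]
        have := Finset.mem_range.1 hj
        omega
    _ = ENNReal.ofReal (cnt * C1) * T := by
        simp only [Finset.sum_const, nsmul_eq_mul, Finset.card_univ]
        rw [← Finset.sum_mul, ENNReal.ofReal_mul (p := (cnt : ℝ)) (by positivity), ENNReal.ofReal_natCast, hcnt]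
        push_cast
        ring
    _ ≤ _ := by
        refine mul_le_mul_left (ENNReal.ofReal_le_ofReal ?_) _
        have h1 := Real.sq_sqrt (show 0 ≤ cnt * C1 by positivity)
        have h2 := Real.sqrt_nonneg (cnt * C1)
        nlinarith

end FRD
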